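/- Suppose there is an integer α ≥ 1 such that dim_K V(2^m) = 1 for all m ≥ α. Then there exists a homogeneous two-sided ideal J of A with E ⊆ J such that A/J is infinite-dimensional over K, prime, left and right Noetherian, and has linear growth; in other words, A/E can be homomorphically mapped onto a graded, prime, Noetherian, infinite-dimensional algebra with linear growth. -/

import Mathlib

/-
Formalization of statements from:
"Golod-Shafarevich algebras of a reduced number of defining relations" (A. Smoktunowicz).

`FA K` is the free associative unital `K`-algebra `A = K⟨x,y⟩` on two generators
(`FreeAlgebra.ι K 0` and `FreeAlgebra.ι K 1`), graded with the generators in degree 1.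
-/

open scoped Pointwise Classical

noncomputable section

/-- The free associative unital `K`-algebra on two generators. -/
abbrev FA (K : Type) [Field K] : Type := FreeAlgebra K (Fin 2)

variable (K : Type) [Field K]

/-- The set of monomials of degree `k` in the free algebra on two generators. -/
def Mon (k : ℕ) : Set (FA K) :=
  { m | ∃ w : List (Fin 2), w.length = k ∧ m = (w.map (FreeAlgebra.ι K)).prod }

/-- `Adeg K k` is the `k`-th homogeneous component `A(k)`: the span of the monomials of
degree `k`. -/
def Adeg (k : ℕ) : Submodule K (FA K) :=
  Submodule.span K (Mon K k)

/-- Properties (1)-(4) of the families `U(2^m)`, `V(2^m)` of subspaces of `A(2^m)`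
(Section 1 of the paper):
(1) `V(2^m)` is spanned by monomials (of degree `2^m`);
(2) `V(2^m) + U(2^m) = A(2^m)` and `V(2^m) ∩ U(2^m) = 0`;
(3) `A(2^{m-1})U(2^{m-1}) + U(2^{m-1})A(2^{m-1}) ⊆ U(2^m)`;
(4) `V(2^m) ⊆ V(2^{m-1})V(2^{m-1})`;
with `V(2^0) = Kx + Ky` and `U(2^0) = 0`. -/
def UVCond (U V : ℕ → Submodule K (FA K)) : Prop :=
  V 0 = Submodule.span K {FreeAlgebra.ι K 0, FreeAlgebra.ι K 1} ∧
  U 0 = ⊥ ∧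
  ∀ m : ℕ, 1 ≤ m →
    (∃ s ⊆ Mon K (2 ^ m), V m = Submodule.span K s) ∧
    U m ≤ Adeg K (2 ^ m) ∧
    V m ⊔ U m = Adeg K (2 ^ m) ∧
    V m ⊓ U m = ⊥ ∧
    Adeg K (2 ^ (m - 1)) * U (m - 1) ⊔ U (m - 1) * Adeg K (2 ^ (m - 1)) ≤ U m ∧
    V m ≤ V (m - 1) * V (m - 1)

/-- The homogeneous component `E(k)` (as a set), for `k ≥ 1`.  For the unique `n` with
`2^(n-1) ≤ k < 2^n` (i.e. `n = Nat.log 2 k + 1`) it consists of those `r ∈ A(k)` with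
`A r A ∩ A(2^(n+1)) ⊆ U(2^n)A(2^n) + A(2^n)U(2^n)`; here `A r A` is the two-sided ideal
generated by `r`, realized as the subspace `⊤ * span{r} * ⊤`. -/
def ESet (U : ℕ → Submodule K (FA K)) (k : ℕ) : Set (FA K) :=
  { r | r ∈ Adeg K k ∧
    (⊤ : Submodule K (FA K)) * Submodule.span K {r} * ⊤ ⊓ Adeg K (2 ^ (Nat.log 2 k + 2)) ≤
      U (Nat.log 2 k + 1) * Adeg K (2 ^ (Nat.log 2 k + 1)) ⊔
        Adeg K (2 ^ (Nat.log 2 k + 1)) * U (Nat.log 2 k + 1) }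

/-- The graded subspace `E = ⊕_{k ≥ 1} E(k)` (each `E(k)` is a subspace, so the span of the
union of the `E(k)` is their direct sum). -/
def Esub (U : ℕ → Submodule K (FA K)) : Submodule K (FA K) :=
  Submodule.span K (⋃ k ∈ Set.Ici 1, ESet K U k)

/-- Auxiliary: the product of the `V(2^p)` over the set bits of `k`, lowest bit first,
with bit positions shifted by `i`. -/
def prodLow (V : ℕ → Submodule K (FA K)) (i k : ℕ) : Submodule K (FA K) :=
  if _h : k = 0 then 1
  else (if k % 2 = 1 then V i else 1) * prodLow V (i + 1) (k / 2)
termination_by k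
decreasing_by exact Nat.div_lt_self (Nat.pos_of_ne_zero _h) one_lt_two

/-- Auxiliary: the product of the `V(2^p)` over the set bits of `k`, highest bit first. -/
def prodHigh (V : ℕ → Submodule K (FA K)) (i k : ℕ) : Submodule K (FA K) :=
  if _h : k = 0 then 1
  else prodHigh V (i + 1) (k / 2) * (if k % 2 = 1 then V i else 1)
termination_by k
decreasing_by exact Nat.div_lt_self (Nat.pos_of_ne_zero _h) one_lt_two

/-- `V^<(k) = V(2^{p_1}) ⋯ V(2^{p_t})` where `k = 2^{p_1} + ⋯ + 2^{p_t}` in binary with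
`p_1 < ⋯ < p_t`; `V^<(0) = K·1`. -/
def Vlt (V : ℕ → Submodule K (FA K)) (k : ℕ) : Submodule K (FA K) := prodLow K V 0 k

/-- `V^>(k) = V(2^{p_t}) ⋯ V(2^{p_1})`; `V^>(0) = K·1`. -/
def Vgt (V : ℕ → Submodule K (FA K)) (k : ℕ) : Submodule K (FA K) := prodHigh K V 0 k

/-- `U^<(k) = Σ_i A(2^{p_1}+⋯+2^{p_{i-1}}) U(2^{p_i}) A(2^{p_{i+1}}+⋯+2^{p_t})`
(for each set bit `p_i` of `k`, the lower part of `k` is `k % 2^{p_i}` and the upper part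
is `k - k % 2^{p_i} - 2^{p_i}`); `U^<(0) = 0`. -/
def Ult (U : ℕ → Submodule K (FA K)) (k : ℕ) : Submodule K (FA K) :=
  ⨆ (p : ℕ) (_ : k.testBit p),
    Adeg K (k % 2 ^ p) * U p * Adeg K (k - k % 2 ^ p - 2 ^ p)

/-- `U^>(k) = Σ_i A(2^{p_t}+⋯+2^{p_{i+1}}) U(2^{p_i}) A(2^{p_{i-1}}+⋯+2^{p_1})`;
`U^>(0) = 0`. -/
def Ugt (U : ℕ → Submodule K (FA K)) (k : ℕ) : Submodule K (FA K) :=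
  ⨆ (p : ℕ) (_ : k.testBit p),
    Adeg K (k - k % 2 ^ p - 2 ^ p) * U p * Adeg K (k % 2 ^ p)

/-- The Capelli polynomial
`d_n(x_1,…,x_n; y_1,…,y_n) = Σ_{σ ∈ Sym(n)} sgn(σ) x_{σ(1)} y_1 x_{σ(2)} y_2 ⋯ x_{σ(n)} y_n`,
evaluated in a ring. -/
def capelli {R : Type*} [Ring R] (n : ℕ) (x y : Fin n → R) : R :=
  ∑ σ : Equiv.Perm (Fin n),
    (Equiv.Perm.sign σ : ℤ) • ((List.finRange n).map fun i => x (σ i) * y i).prod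

/-- The quotient map `R → R ⧸ c` (for a ring congruence `c`) as a `K`-linear map. -/
def mkLin {R : Type*} [Semiring R] [Algebra K R] (c : RingCon R) :
    R →ₗ[K] c.Quotient where
  toFun := RingCon.toQuotient
  map_add' _ _ := rfl
  map_smul' _ _ := rfl

/-- A two-sided ideal of the free algebra is homogeneous iff it is spanned by its
homogeneous elements. -/
def IsHomogTSI (J : TwoSidedIdeal (FA K)) : Prop :=
  (J : Set (FA K)) ⊆ ↑(Submodule.span K {a : FA K | a ∈ J ∧ ∃ n, a ∈ Adeg K n})

/-- `S = ⋃_{n ∈ Y} {n - e(n) - 1, …, n - 1}`. -/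
def SetS (Y : Set ℕ) (e : ℕ → ℕ) : Set ℕ :=
  ⋃ n ∈ Y, Set.Icc (n - e n - 1) (n - 1)

/-- Conditions (1)-(8) of Theorem 4.1 of the paper, at index `m`, for the families
`F(2^m)`, `U(2^m)`, `V(2^m)` of subspaces of `A(2^m)`:
(1) `dim V(2^m) = 2` if `m ∉ S` and (in case `Y` is finite) `m ≤ max Y`;
(2) `dim V(2^{k-e(k)-1+j}) = 2^{2^j}` for all `k ∈ Y` and `0 ≤ j ≤ e(k)`;
(3) `V(2^m)` is spanned by monomials;
(4) `F(2^m) ⊆ U(2^m)` for `m ∈ Y`, and `F(2^m) = 0` for `m ∉ Y`;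
(5) `V(2^m) ⊕ U(2^m) = A(2^m)`;
(6) `A(2^{m-1})U(2^{m-1}) + U(2^{m-1})A(2^{m-1}) ⊆ U(2^m)`;
(7) `V(2^m) ⊆ V(2^{m-1})V(2^{m-1})`;
(8) if `Y` is finite and `m > max Y`, then `dim V(2^m) = 1`. -/
def Conds (Y : Set ℕ) (e : ℕ → ℕ) (F U V : ℕ → Submodule K (FA K)) (m : ℕ) : Prop :=
  (m ∉ SetS Y e → (Y.Finite → ∃ k ∈ Y, m ≤ k) → Module.finrank K (V m) = 2) ∧
  (∀ k ∈ Y, ∀ j ≤ e k, k - e k - 1 + j = m → Module.finrank K (V m) = 2 ^ 2 ^ j) ∧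
  (∃ s ⊆ Mon K (2 ^ m), V m = Submodule.span K s) ∧
  (m ∈ Y → F m ≤ U m) ∧ (m ∉ Y → F m = ⊥) ∧
  U m ≤ Adeg K (2 ^ m) ∧
  V m ⊔ U m = Adeg K (2 ^ m) ∧ V m ⊓ U m = ⊥ ∧
  (Adeg K (2 ^ (m - 1)) * U (m - 1) ⊔ U (m - 1) * Adeg K (2 ^ (m - 1)) ≤ U m) ∧
  V m ≤ V (m - 1) * V (m - 1) ∧
  (Y.Finite → (∀ k ∈ Y, k < m) → Module.finrank K (V m) = 1)

section FreeAlgebraWords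

open Polynomial

variable {K}

/-- The monomial of the free algebra spelled by a word. -/
def mono (K : Type) [Field K] (l : List (Fin 2)) : FA K := (l.map (FreeAlgebra.ι K)).prod

lemma mono_append (u v : List (Fin 2)) : mono K (u ++ v) = mono K u * mono K v := by
  simp [mono]

@[simp]
lemma mono_nil : mono K [] = 1 := rfl

lemma basisFreeMonoid_eq_mono (w : FreeMonoid (Fin 2)) :
    FreeAlgebra.basisFreeMonoid K (Fin 2) w = mono K w.toList := by
  simp [FreeAlgebra.basisFreeMonoid, FreeAlgebra.equivMonoidAlgebraFreeMonoid,
    MonoidAlgebra.coeffLinearEquiv, mono, FreeMonoid.lift_apply]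

lemma span_range_mono : Submodule.span K (Set.range (mono K)) = ⊤ := by
  have h := (FreeAlgebra.basisFreeMonoid K (Fin 2)).span_eq
  rwa [show (⇑(FreeAlgebra.basisFreeMonoid K (Fin 2)) : FreeMonoid (Fin 2) → FA K) = mono K from
    funext basisFreeMonoid_eq_mono] at h

/-- The weighted degree map: the word `l` is sent to `φ l • X ^ |l|`. -/
def wordPoly (φ : List (Fin 2) → K) : FA K →ₗ[K] K[X] :=
  (FreeAlgebra.basisFreeMonoid K (Fin 2)).constr K
    fun w => monomial w.toList.length (φ w.toList)

@[simp]
lemma wordPoly_mono (φ : List (Fin 2) → K) (l : List (Fin 2)) :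
    wordPoly φ (mono K l) = monomial l.length (φ l) := by
  have h := (FreeAlgebra.basisFreeMonoid K (Fin 2)).constr_basis K
    (fun w => (monomial w.toList.length (φ w.toList) : K[X])) (FreeMonoid.ofList l)
  rw [basisFreeMonoid_eq_mono] at h
  exact h

lemma linearMap_ext_mono {M : Type*} [AddCommMonoid M] [Module K M] {f g : FA K →ₗ[K] M}
    (h : ∀ l, f (mono K l) = g (mono K l)) : f = g := by
  refine LinearMap.ext_on_range span_range_mono h

lemma mono_mem_Adeg (l : List (Fin 2)) : mono K l ∈ Adeg K l.length :=
  Submodule.subset_span ⟨l, rfl, rfl⟩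

lemma Adeg_induction {k : ℕ} {p : FA K → Prop}
    (hmono : ∀ l : List (Fin 2), l.length = k → p (mono K l)) (hzero : p 0)
    (hadd : ∀ x y, p x → p y → p (x + y)) (hsmul : ∀ (c : K) x, p x → p (c • x))
    {x : FA K} (hx : x ∈ Adeg K k) : p x := by
  refine Submodule.span_induction ?_ hzero (fun x y _ _ => hadd x y) (fun c x _ => hsmul c x) hx
  rintro _ ⟨l, hl, rfl⟩
  exact hmono l hl

lemma Adeg_mul (i j : ℕ) : Adeg K i * Adeg K j = Adeg K (i + j) := by
  rw [Adeg, Adeg, Adeg, Submodule.span_mul_span]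
  congr 1
  ext x
  constructor
  · rintro ⟨_, ⟨u, hu, rfl⟩, _, ⟨v, hv, rfl⟩, rfl⟩
    exact ⟨u ++ v, by simp [hu, hv], (mono_append u v).symm⟩
  · rintro ⟨l, hl, rfl⟩
    refine ⟨_, ⟨l.take i, by simp [hl], rfl⟩, _, ⟨l.drop i, by simp [hl], rfl⟩, ?_⟩
    simp [← List.prod_append]

/-- The span of the words of length less than `h`. -/
def Alt (K : Type) [Field K] (h : ℕ) : Submodule K (FA K) :=
  Submodule.span K (mono K '' {l | l.length < h})

lemma Adeg_le_Alt {k h : ℕ} (hk : k < h) : Adeg K k ≤ Alt K h := by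
  refine Submodule.span_mono ?_
  rintro _ ⟨l, rfl, rfl⟩
  exact ⟨l, hk, rfl⟩

lemma Alt_mono {i j : ℕ} (h : i ≤ j) : Alt K i ≤ Alt K j :=
  Submodule.span_mono (Set.image_mono fun _ hl => lt_of_lt_of_le hl h)

lemma Alt_zero : Alt K 0 = ⊥ := by simp [Alt]

lemma Alt_succ (h : ℕ) : Alt K (h + 1) = Adeg K h ⊔ Alt K h := by
  refine le_antisymm ?_ (sup_le (Adeg_le_Alt h.lt_succ_self) (Alt_mono h.le_succ))
  refine Submodule.span_le.2 ?_
  rintro _ ⟨l, hl, rfl⟩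
  rcases Nat.lt_succ_iff_lt_or_eq.1 hl with hl | hl
  · exact Submodule.mem_sup_right (Submodule.subset_span ⟨l, hl, rfl⟩)
  · exact Submodule.mem_sup_left (hl ▸ mono_mem_Adeg (K := K) l)

lemma Alt_mul_Adeg (i j : ℕ) : Alt K i * Adeg K j ≤ Alt K (i + j) := by
  rw [Alt, Adeg, Submodule.span_mul_span, Submodule.span_le]
  rintro _ ⟨_, ⟨u, hu, rfl⟩, _, ⟨v, hv, rfl⟩, rfl⟩
  refine Submodule.subset_span ⟨u ++ v, ?_, mono_append u v⟩
  simp only [Set.mem_ofPred_eq, List.length_append] at hu ⊢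
  omega

lemma Adeg_mul_Alt (i j : ℕ) : Adeg K i * Alt K j ≤ Alt K (i + j) := by
  rw [Alt, Adeg, Submodule.span_mul_span, Submodule.span_le]
  rintro _ ⟨_, ⟨u, hu, rfl⟩, _, ⟨v, hv, rfl⟩, rfl⟩
  refine Submodule.subset_span ⟨u ++ v, ?_, mono_append u v⟩
  simp only [Set.mem_ofPred_eq, List.length_append] at hv ⊢
  omega

lemma Alt_mul_Alt (i j : ℕ) : Alt K i * Alt K j ≤ Alt K (i + j) := by
  rw [Alt, Alt, Submodule.span_mul_span, Submodule.span_le]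
  rintro _ ⟨_, ⟨u, hu, rfl⟩, _, ⟨v, hv, rfl⟩, rfl⟩
  refine Submodule.subset_span ⟨u ++ v, ?_, mono_append u v⟩
  simp only [Set.mem_ofPred_eq, List.length_append] at hu hv ⊢
  omega

instance Alt_finite (h : ℕ) : Module.Finite K (Alt K h) :=
  Module.Finite.span_of_finite K (((List.finite_length_lt (Fin 2) h).image (mono K)))

lemma exists_mem_Alt (x : FA K) : ∃ h, x ∈ Alt K h := by
  have hx : x ∈ Submodule.span K (Set.range (mono K)) := by
    rw [span_range_mono]; exact Submodule.mem_top
  refine Submodule.span_induction ?_ ⟨0, zero_mem _⟩ ?_ ?_ hx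
  · rintro _ ⟨l, rfl⟩
    exact ⟨l.length + 1, Adeg_le_Alt l.length.lt_succ_self (mono_mem_Adeg l)⟩
  · rintro x y - - ⟨i, hi⟩ ⟨j, hj⟩
    exact ⟨max i j, add_mem (Alt_mono (le_max_left _ _) hi) (Alt_mono (le_max_right _ _) hj)⟩
  · rintro c x - ⟨i, hi⟩
    exact ⟨i, Submodule.smul_mem _ c hi⟩

/-- An element outside a subspace `L` has a leading component outside `L`, once the components
of higher degree that lie in `L` are discarded. -/
lemma exists_leading (L : Submodule K (FA K)) {x : FA K} (hx : x ∉ L) :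
    ∃ (h : ℕ) (t s : FA K), t ∈ Adeg K h ∧ t ∉ L ∧ s ∈ Alt K h ∧ x - (t + s) ∈ L := by
  obtain ⟨n, hn⟩ := exists_mem_Alt x
  induction n generalizing x with
  | zero =>
    rw [Alt_zero, Submodule.mem_bot] at hn
    exact absurd (hn ▸ zero_mem L) hx
  | succ n ih =>
    rw [Alt_succ] at hn
    obtain ⟨t, ht, s, hs, rfl⟩ := Submodule.mem_sup.1 hn
    by_cases htL : t ∈ L
    · obtain ⟨h, t', s', ht', htL', hs', hL⟩ := ih (fun h => hx (add_mem htL h)) hs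
      refine ⟨h, t', s', ht', htL', hs', ?_⟩
      rw [add_sub_assoc]
      exact add_mem htL hL
    · exact ⟨n, t, s, ht, htL, hs, by simp⟩

variable (φ : List (Fin 2) → K)

lemma wordPoly_of_mem_Adeg {k : ℕ} {x : FA K} (hx : x ∈ Adeg K k) :
    ∃ c, wordPoly φ x = monomial k c := by
  refine Adeg_induction (p := fun x => ∃ c, wordPoly φ x = monomial k c) ?_ ⟨0, by simp⟩ ?_ ?_ hx
  · rintro l rfl
    exact ⟨_, wordPoly_mono φ l⟩
  · rintro x y ⟨c, hc⟩ ⟨d, hd⟩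
    exact ⟨c + d, by simp [hc, hd]⟩
  · rintro a x ⟨c, hc⟩
    exact ⟨a * c, by simp [hc, smul_monomial]⟩

lemma wordPoly_of_mem_Alt {h : ℕ} {x : FA K} (hx : x ∈ Alt K h) :
    wordPoly φ x ∈ degreeLT K h := by
  refine Submodule.span_le (p := (degreeLT K h).comap (wordPoly φ)).2 ?_ hx
  rintro _ ⟨l, hl, rfl⟩
  rw [SetLike.mem_coe, Submodule.mem_comap, wordPoly_mono, mem_degreeLT]
  exact (degree_monomial_le _ _).trans_lt (Nat.cast_lt.2 hl)

/-- If a homogeneous element plus terms of lower degree is killed, the homogeneous element is. -/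
lemma wordPoly_eq_zero_of_add {h : ℕ} {t s : FA K} (ht : t ∈ Adeg K h) (hs : s ∈ Alt K h)
    (h0 : wordPoly φ (t + s) = 0) : wordPoly φ t = 0 := by
  obtain ⟨c, hc⟩ := wordPoly_of_mem_Adeg φ ht
  have hs' := wordPoly_of_mem_Alt φ hs
  rw [mem_degreeLT] at hs'
  have h1 := congrArg (fun p => coeff p h) h0
  simp only [map_add, coeff_add, hc, coeff_monomial_same, coeff_zero,
    coeff_eq_zero_of_degree_lt hs', add_zero] at h1
  rw [hc, h1, map_zero]

lemma forall_of_forall_mono {M : Type*} [AddCommMonoid M] [Module K M] (f : FA K →ₗ[K] M)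
    (h : ∀ l, f (mono K l) = 0) (x : FA K) : f x = 0 := by
  rw [linearMap_ext_mono (f := f) (g := 0) (by simpa using h), LinearMap.zero_apply]

/-- A weight on words that vanishes off the lengths divisible by `N` and is multiplicative on
concatenations at such lengths. -/
structure BlockMul (N : ℕ) (φ : List (Fin 2) → K) : Prop where
  eq_zero : ∀ l, ¬ N ∣ l.length → φ l = 0
  mul : ∀ u v, N ∣ u.length → φ (u ++ v) = φ u * φ v

namespace BlockMul

variable {φ} {N : ℕ} (hφ : BlockMul N φ)
include hφ

lemma mul' (u v : List (Fin 2)) (hv : N ∣ v.length) : φ (u ++ v) = φ u * φ v := by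
  by_cases hu : N ∣ u.length
  · exact hφ.mul u v hu
  · rw [hφ.eq_zero u hu, zero_mul, hφ.eq_zero]
    rwa [List.length_append, Nat.dvd_add_left hv]

lemma reverse : BlockMul N fun l => φ l.reverse where
  eq_zero l hl := hφ.eq_zero _ (by simpa using hl)
  mul u v hu := by
    simp only [List.reverse_append]
    rw [hφ.mul' _ _ (by simpa using hu), mul_comm]

lemma wordPoly_mul {k : ℕ} (hk : N ∣ k) {x : FA K} (hx : x ∈ Adeg K k) (y : FA K) :
    wordPoly φ (x * y) = wordPoly φ x * wordPoly φ y := by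
  refine Adeg_induction (p := fun x => wordPoly φ (x * y) = wordPoly φ x * wordPoly φ y)
    ?_ (by simp) ?_ ?_ hx
  · rintro u rfl
    have h := linearMap_ext_mono (f := wordPoly φ ∘ₗ LinearMap.mulLeft K (mono K u))
      (g := LinearMap.mulLeft K (wordPoly φ (mono K u)) ∘ₗ wordPoly φ) fun v => by
        simp [← mono_append, monomial_mul_monomial, hφ.mul u v hk]
    exact LinearMap.congr_fun h y
  · intro a b ha hb
    simp [add_mul, ha, hb]
  · intro c a ha
    simp [ha]

lemma wordPoly_mul' {k : ℕ} (hk : N ∣ k) (x : FA K) {y : FA K} (hy : y ∈ Adeg K k) :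
    wordPoly φ (x * y) = wordPoly φ x * wordPoly φ y := by
  refine Adeg_induction (p := fun y => wordPoly φ (x * y) = wordPoly φ x * wordPoly φ y)
    ?_ (by simp) ?_ ?_ hy
  · rintro v rfl
    have h := linearMap_ext_mono (f := wordPoly φ ∘ₗ LinearMap.mulRight K (mono K v))
      (g := LinearMap.mulRight K (wordPoly φ (mono K v)) ∘ₗ wordPoly φ) fun u => by
        simp [← mono_append, monomial_mul_monomial, hφ.mul' u v hk]
    exact LinearMap.congr_fun h x
  · intro a b ha hb
    simp [mul_add, ha, hb]
  · intro c a ha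
    simp [ha]

lemma wordPoly_eq_zero {k : ℕ} (hk : ¬ N ∣ k) {x : FA K} (hx : x ∈ Adeg K k) :
    wordPoly φ x = 0 := by
  refine Adeg_induction (p := fun x => wordPoly φ x = 0) ?_ (by simp) ?_ ?_ hx
  · rintro u rfl
    rw [wordPoly_mono, hφ.eq_zero u hk, map_zero]
  · intro a b ha hb
    simp [ha, hb]
  · intro c a ha
    simp [ha]

end BlockMul

/-- The largest two-sided ideal on which `wordPoly φ` vanishes. -/
def syntacticIdeal (φ : List (Fin 2) → K) : TwoSidedIdeal (FA K) :=
  TwoSidedIdeal.mk' {r | ∀ a b, wordPoly φ (a * r * b) = 0} (by simp)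
    (fun {x y} hx hy a b => by rw [mul_add, add_mul, map_add, hx, hy, add_zero])
    (fun {x} hx a b => by rw [mul_neg, neg_mul, map_neg, hx, neg_zero])
    (fun {x y} hy a b => by rw [← mul_assoc a, hy])
    (fun {x y} hx a b => by rw [← mul_assoc a, mul_assoc, hx])

variable {φ}

lemma mem_syntacticIdeal {r : FA K} :
    r ∈ syntacticIdeal φ ↔ ∀ a b, wordPoly φ (a * r * b) = 0 := by
  rw [syntacticIdeal, TwoSidedIdeal.mem_mk']
  rfl

lemma mem_syntacticIdeal_iff_mono {r : FA K} :
    r ∈ syntacticIdeal φ ↔ ∀ p q, wordPoly φ (mono K p * r * mono K q) = 0 := by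
  rw [mem_syntacticIdeal]
  refine ⟨fun h p q => h _ _, fun h a b => ?_⟩
  refine forall_of_forall_mono (wordPoly φ ∘ₗ LinearMap.mulLeft K (a * r)) (fun q => ?_) b
  exact forall_of_forall_mono (wordPoly φ ∘ₗ LinearMap.mulRight K (r * mono K q))
    (fun p => by simpa [mul_assoc] using h p q) a |> fun h => by simpa [mul_assoc] using h

lemma wordPoly_eq_zero_of_mem {r : FA K} (hr : r ∈ syntacticIdeal φ) : wordPoly φ r = 0 := by
  simpa using mem_syntacticIdeal.1 hr 1 1

lemma mul_mem_Adeg {i j : ℕ} {x y : FA K} (hx : x ∈ Adeg K i) (hy : y ∈ Adeg K j) :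
    x * y ∈ Adeg K (i + j) :=
  Adeg_mul (K := K) i j ▸ Submodule.mul_mem_mul hx hy

lemma mul_mem_Alt_left {i j : ℕ} {x y : FA K} (hx : x ∈ Alt K i) (hy : y ∈ Adeg K j) :
    x * y ∈ Alt K (i + j) :=
  Alt_mul_Adeg i j (Submodule.mul_mem_mul hx hy)

lemma mul_mem_Alt_right {i j : ℕ} {x y : FA K} (hx : x ∈ Adeg K i) (hy : y ∈ Alt K j) :
    x * y ∈ Alt K (i + j) :=
  Adeg_mul_Alt i j (Submodule.mul_mem_mul hx hy)

lemma leading_mem_syntacticIdeal {h : ℕ} {t s : FA K} (ht : t ∈ Adeg K h) (hs : s ∈ Alt K h)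
    (hts : t + s ∈ syntacticIdeal φ) : t ∈ syntacticIdeal φ := by
  rw [mem_syntacticIdeal_iff_mono] at hts ⊢
  intro p q
  refine wordPoly_eq_zero_of_add φ (s := mono K p * s * mono K q)
    (mul_mem_Adeg (mul_mem_Adeg (mono_mem_Adeg p) ht) (mono_mem_Adeg q))
    (mul_mem_Alt_left (mul_mem_Alt_right (mono_mem_Adeg p) hs) (mono_mem_Adeg q)) ?_
  rw [← add_mul, ← mul_add, hts]

lemma isHomogTSI_syntacticIdeal : IsHomogTSI K (syntacticIdeal φ) := by
  intro r hr
  obtain ⟨n, hn⟩ := exists_mem_Alt r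
  induction n generalizing r with
  | zero =>
    rw [Alt_zero, Submodule.mem_bot] at hn
    exact hn ▸ zero_mem _
  | succ n ih =>
    rw [Alt_succ] at hn
    obtain ⟨t, ht, s, hs, rfl⟩ := Submodule.mem_sup.1 hn
    have htJ : t ∈ syntacticIdeal φ := leading_mem_syntacticIdeal ht hs hr
    have hsJ : s ∈ syntacticIdeal φ := by
      have := (syntacticIdeal φ).sub_mem hr htJ
      rwa [add_sub_cancel_left] at this
    exact add_mem (Submodule.subset_span ⟨htJ, n, ht⟩) (ih hsJ hs)

lemma BlockMul.mem_or_mem {N : ℕ} (hφ : BlockMul N φ) {a b : FA K}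
    (hab : ∀ x, a * x * b ∈ syntacticIdeal φ) :
    a ∈ syntacticIdeal φ ∨ b ∈ syntacticIdeal φ := by
  by_contra! h
  obtain ⟨ha, hb⟩ := h
  let L : Submodule K (FA K) := (syntacticIdeal φ).asIdeal.restrictScalars K
  have hL (x) : x ∈ L ↔ x ∈ syntacticIdeal φ := TwoSidedIdeal.mem_asIdeal
  obtain ⟨i, t, s, ht, htL, hs, hL1⟩ := exists_leading L (mt (hL a).1 ha)
  obtain ⟨j, t', s', ht', htL', hs', hL2⟩ := exists_leading L (mt (hL b).1 hb)
  rw [hL] at htL hL1 htL' hL2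
  rw [mem_syntacticIdeal_iff_mono] at htL htL'
  push Not at htL htL'
  obtain ⟨p, q, h1⟩ := htL
  obtain ⟨p', q', h2⟩ := htL'
  set y := mono K q * mono K p' with hy
  have hyd : y ∈ Adeg K (q.length + p'.length) :=
    mul_mem_Adeg (mono_mem_Adeg _) (mono_mem_Adeg _)
  have hmem : (t + s) * y * (t' + s') ∈ syntacticIdeal φ := by
    have e : (t + s) * y * (t' + s') = a * y * b - (a - (t + s)) * (y * b)
        - (t + s) * y * (b - (t' + s')) := by noncomm_ring
    rw [e]
    exact (syntacticIdeal φ).sub_mem ((syntacticIdeal φ).sub_mem (hab y)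
      ((syntacticIdeal φ).mul_mem_right _ _ hL1)) ((syntacticIdeal φ).mul_mem_left _ _ hL2)
  have htop : t * y * t' ∈ syntacticIdeal φ := by
    refine leading_mem_syntacticIdeal (s := t * y * s' + s * y * (t' + s'))
      (mul_mem_Adeg (mul_mem_Adeg ht hyd) ht') (add_mem ?_ ?_)
      (by convert hmem using 1; noncomm_ring)
    · exact mul_mem_Alt_right (mul_mem_Adeg ht hyd) hs'
    · rw [mul_add]
      refine add_mem (mul_mem_Alt_left (mul_mem_Alt_left hs hyd) ht') ?_
      exact Alt_mul_Alt _ _ (Submodule.mul_mem_mul (mul_mem_Alt_left hs hyd) hs')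
  have h3 := mem_syntacticIdeal.1 htop (mono K p) (mono K q')
  have hdeg := mul_mem_Adeg (mul_mem_Adeg (mono_mem_Adeg p) ht) (mono_mem_Adeg (K := K) q)
  have hdvd : N ∣ p.length + i + q.length := by
    by_contra hN
    exact h1 (hφ.wordPoly_eq_zero hN hdeg)
  rw [show mono K p * (t * y * t') * mono K q' =
      (mono K p * t * mono K q) * (mono K p' * t' * mono K q') by simp only [hy, mul_assoc],
    hφ.wordPoly_mul hdvd hdeg] at h3
  exact (mul_ne_zero h1 h2) h3

/-- The largest left ideal on which `wordPoly φ` vanishes. -/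
def syntacticLeftIdeal (φ : List (Fin 2) → K) : Ideal (FA K) where
  carrier := {r | ∀ a, wordPoly φ (a * r) = 0}
  add_mem' {x y} hx hy a := by rw [mul_add, map_add, hx, hy, add_zero]
  zero_mem' := by simp
  smul_mem' c x hx a := by rw [smul_eq_mul, ← mul_assoc, hx]

lemma mem_syntacticLeftIdeal_iff_mono {r : FA K} :
    r ∈ syntacticLeftIdeal φ ↔ ∀ p, wordPoly φ (mono K p * r) = 0 :=
  ⟨fun h p => h _, fun h a => forall_of_forall_mono
    (wordPoly φ ∘ₗ LinearMap.mulRight K r) (fun p => by simpa using h p) a⟩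

/-- A left ideal strictly larger than the syntactic left ideal is of finite codimension. -/
lemma BlockMul.exists_sup_Alt_eq_top {N : ℕ} (hφ : BlockMul N φ) {Q : Ideal (FA K)}
    (hQ : syntacticLeftIdeal φ < Q) : ∃ h, Q.restrictScalars K ⊔ Alt K h = ⊤ := by
  obtain ⟨hle, q, hqQ, hqL⟩ := SetLike.lt_iff_le_and_exists.1 hQ
  obtain ⟨i, t, s, ht, htL, hs, hqts⟩ :=
    exists_leading ((syntacticLeftIdeal φ).restrictScalars K) (x := q) hqL
  have hts : t + s ∈ Q := by simpa using Q.sub_mem hqQ (hle hqts)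
  rw [Submodule.restrictScalars_mem, mem_syntacticLeftIdeal_iff_mono] at htL
  push Not at htL
  obtain ⟨b, hb⟩ := htL
  have htd := mul_mem_Adeg (mono_mem_Adeg b) ht
  have hsd := mul_mem_Alt_right (mono_mem_Adeg b) hs
  have hbQ : mono K b * t + mono K b * s ∈ Q := by
    rw [← mul_add]; exact Q.mul_mem_left _ hts
  generalize mono K b * t = t at *
  generalize mono K b * s = s at *
  generalize b.length + i = h at *
  have hdvd : N ∣ h := by
    by_contra hN
    exact hb (hφ.wordPoly_eq_zero hN htd)
  obtain ⟨c, hc⟩ := wordPoly_of_mem_Adeg φ htd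
  have hc0 : c ≠ 0 := by
    rintro rfl
    simp [hc] at hb
  refine ⟨h, ?_⟩
  have key (n : ℕ) : Alt K n ≤ Q.restrictScalars K ⊔ Alt K h := by
    induction n with
    | zero => simp [Alt_zero]
    | succ n ih =>
      rw [Alt_succ]
      refine sup_le ?_ ih
      rcases lt_or_ge n h with hn | hn
      · exact (Adeg_le_Alt hn).trans le_sup_right
      obtain ⟨k, rfl⟩ := Nat.exists_eq_add_of_le' hn
      refine Submodule.span_le.2 ?_
      rintro _ ⟨l, hl, rfl⟩
      set u := l.take k with hu
      set v := l.drop k with hv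
      have hul : u.length = k := by simp [hu, hl]
      have hvl : v.length = h := by simp [hv, hl]
      have huv : mono K l = mono K u * mono K v := by
        rw [← mono_append, List.take_append_drop]
      have hvd : mono K v ∈ Adeg K h := hvl ▸ mono_mem_Adeg v
      have hy : mono K v - (φ v / c) • t ∈ syntacticLeftIdeal φ := by
        intro a
        rw [hφ.wordPoly_mul' hdvd a (sub_mem hvd (Submodule.smul_mem _ _ htd)), map_sub,
          map_smul, hc, wordPoly_mono, hvl, smul_monomial, smul_eq_mul, div_mul_cancel₀ _ hc0,
          sub_self, mul_zero]
      have e : mono K l = mono K u * (mono K v - (φ v / c) • t)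
          + (φ v / c) • (mono K u * (t + s)) - (φ v / c) • (mono K u * s) := by
        rw [huv, mul_sub, mul_add, smul_add, mul_smul_comm]
        abel
      change mono K l ∈ _
      rw [e]
      refine sub_mem (Submodule.mem_sup_left (add_mem ?_ ?_)) (Submodule.smul_mem _ _ (ih ?_))
      · exact Q.mul_mem_left _ (hle hy)
      · exact Submodule.smul_mem (Q.restrictScalars K) _ (Q.mul_mem_left _ hbQ)
      · exact mul_mem_Alt_right (hul ▸ mono_mem_Adeg u) hsd
  rw [eq_top_iff]
  intro x _
  obtain ⟨n, hn⟩ := exists_mem_Alt x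
  exact key n hn

/-- A module all of whose nonzero submodules have finite codimension is Noetherian. -/
lemma isNoetherian_of_finite_quotient {F A M : Type*} [Field F] [Ring A] [Algebra F A]
    [AddCommGroup M] [Module F M] [Module A M] [IsScalarTower F A M]
    (h : ∀ P : Submodule A M, P ≠ ⊥ → Module.Finite F (M ⧸ P)) : IsNoetherian A M := by
  refine ⟨fun P => ?_⟩
  by_cases hP : P = ⊥
  · exact hP ▸ Submodule.fg_bot
  obtain ⟨x, hxP, hx⟩ := Submodule.exists_mem_ne_zero_of_ne_bot hP
  have hfin := h (Submodule.span A {x}) (by simpa using hx)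
  have : IsNoetherian A (M ⧸ Submodule.span A {x}) :=
    isNoetherian_of_tower F (inferInstance : IsNoetherian F _)
  refine Submodule.fg_of_fg_map_of_fg_inf_ker (Submodule.span A {x}).mkQ
    (IsNoetherian.noetherian _) ?_
  rw [Submodule.ker_mkQ, inf_eq_right.2 (by simpa using hxP)]
  exact Submodule.fg_span_singleton x

lemma BlockMul.isNoetherian_quotient {N : ℕ} (hφ : BlockMul N φ) :
    IsNoetherian (FA K) (FA K ⧸ syntacticLeftIdeal φ) := by
  refine isNoetherian_of_finite_quotient (F := K) fun P hP => ?_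
  have hlt : syntacticLeftIdeal φ < P.comap (syntacticLeftIdeal φ).mkQ := by
    refine lt_of_le_of_ne
      (by simpa using LinearMap.ker_le_comap (syntacticLeftIdeal φ).mkQ (p := P))
      fun h => hP ?_
    rw [← Submodule.map_comap_eq_of_surjective (Submodule.mkQ_surjective _) P, ← h]
    simp
  obtain ⟨n, hn⟩ := hφ.exists_sup_Alt_eq_top hlt
  let g : FA K →ₗ[K] (FA K ⧸ syntacticLeftIdeal φ) ⧸ P :=
    (P.mkQ ∘ₗ (syntacticLeftIdeal φ).mkQ).restrictScalars K
  have hg : Function.Surjective g :=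
    (Submodule.mkQ_surjective P).comp (Submodule.mkQ_surjective _)
  refine Module.Finite.of_surjective (g ∘ₗ (Alt K n).subtype) fun y => ?_
  obtain ⟨x, rfl⟩ := hg y
  obtain ⟨q, hq, r, hr, rfl⟩ := Submodule.mem_sup.1 (hn ▸ Submodule.mem_top : x ∈ _)
  refine ⟨⟨r, hr⟩, ?_⟩
  have : g q = 0 := (Submodule.Quotient.mk_eq_zero P).2 hq
  simp [this]

/-- Membership in the syntactic ideal is tested by finitely many words. -/
lemma BlockMul.mem_syntacticIdeal_of_short {N : ℕ} (hφ : BlockMul N φ) (hN : 0 < N) {r : FA K}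
    (h : ∀ p q : List (Fin 2), p.length < N → q.length < N →
      wordPoly φ (mono K p * r * mono K q) = 0) : r ∈ syntacticIdeal φ := by
  rw [mem_syntacticIdeal_iff_mono]
  intro p q
  set k := N * (p.length / N) with hk
  set m := q.length % N with hm
  have hkl : k ≤ p.length := Nat.mul_div_le _ _
  have hml : m ≤ q.length := Nat.mod_le _ _
  have e : mono K p * r * mono K q = mono K (p.take k) *
      (mono K (p.drop k) * r * mono K (q.take m) * mono K (q.drop m)) := by
    conv_lhs => rw [← List.take_append_drop k p, ← List.take_append_drop m q,
      mono_append, mono_append]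
    simp only [mul_assoc]
  have h1 : N ∣ (p.take k).length := by
    rw [List.length_take, min_eq_left hkl, hk]; exact Nat.dvd_mul_right _ _
  have h2 : N ∣ (q.drop m).length := by
    rw [List.length_drop, hm]; exact Nat.dvd_sub_mod _
  rw [e, hφ.wordPoly_mul h1 (mono_mem_Adeg _), hφ.wordPoly_mul' h2 _ (mono_mem_Adeg _), h,
    zero_mul, mul_zero]
  · rw [List.length_drop]
    have := Nat.div_add_mod p.length N
    have := Nat.mod_lt p.length hN
    omega
  · simpa [hm] using Or.inl (Nat.mod_lt _ hN)

lemma BlockMul.isNoetherianRing_of_surjective {N : ℕ} (hφ : BlockMul N φ) (hN : 0 < N)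
    {S : Type*} [Ring S] (g : FA K →+* S) (hg : Function.Surjective g)
    (hker : ∀ r ∈ syntacticIdeal φ, g r = 0) : IsNoetherianRing S := by
  have : Finite {l : List (Fin 2) | l.length < N} := List.finite_length_lt (Fin 2) N
  have := hφ.isNoetherian_quotient
  let Φ : FA K →ₗ[FA K] ({l : List (Fin 2) | l.length < N} → FA K ⧸ syntacticLeftIdeal φ) :=
    LinearMap.pi fun v => (syntacticLeftIdeal φ).mkQ ∘ₗ LinearMap.toSpanSingleton _ _ (mono K v)
  let _ : Module (FA K) S := Module.compHom S g
  have _ : IsScalarTower (FA K) S S := ⟨fun a b c => mul_assoc (g a) b c⟩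
  let gl : FA K →ₗ[FA K] S :=
    { toFun := g, map_add' := map_add g, map_smul' := fun a b => map_mul g a b }
  have hle : LinearMap.ker Φ ≤ LinearMap.ker gl := by
    intro r hr
    refine hker r (hφ.mem_syntacticIdeal_of_short hN fun p q _ hq => ?_)
    have h1 := congrFun (LinearMap.mem_ker.1 hr) ⟨q, hq⟩
    have h2 : r * mono K q ∈ syntacticLeftIdeal φ := (Submodule.Quotient.mk_eq_zero _).1 h1
    rw [mul_assoc]
    exact h2 _
  have : IsNoetherian (FA K) (FA K ⧸ LinearMap.ker Φ) :=
    isNoetherian_of_linearEquiv Φ.quotKerEquivRange.symm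
  refine isNoetherian_of_tower (FA K) 
    (isNoetherian_of_surjective (f := (LinearMap.ker Φ).liftQ gl hle) ?_)
  rw [Submodule.range_liftQ]
  exact LinearMap.range_eq_top.2 hg

lemma mono_star (l : List (Fin 2)) : star (mono K l) = mono K l.reverse := by
  induction l with
  | nil => simp
  | cons a l ih =>
    rw [List.reverse_cons, mono_append, ← ih, ← List.singleton_append, mono_append, star_mul]
    simp [mono]

lemma wordPoly_star (x : FA K) : wordPoly φ (star x) = wordPoly (fun l => φ l.reverse) x := by
  refine LinearMap.congr_fun (f := wordPoly φ ∘ₗ ((MulOpposite.opLinearEquiv K).symm.toLinearMap ∘ₗ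
    (FreeAlgebra.starHom (R := K) (X := Fin 2)).toLinearMap)) (linearMap_ext_mono fun l => ?_) x
  change wordPoly φ (star (mono K l)) = _
  simp [mono_star]

lemma star_mem_syntacticIdeal {r : FA K} (hr : r ∈ syntacticIdeal fun l => φ l.reverse) :
    star r ∈ syntacticIdeal φ := by
  rw [mem_syntacticIdeal] at hr ⊢
  intro a b
  have := hr (star b) (star a)
  rw [← wordPoly_star] at this
  simpa [mul_assoc] using this

lemma toQuotient_eq_zero {J : TwoSidedIdeal (FA K)} {r : FA K} :
    (RingCon.toQuotient r : J.ringCon.Quotient) = 0 ↔ r ∈ J := by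
  rw [TwoSidedIdeal.mem_iff]
  exact J.ringCon.eq

lemma BlockMul.isNoetherianRing {N : ℕ} (hφ : BlockMul N φ) (hN : 0 < N) :
    IsNoetherianRing (syntacticIdeal φ).ringCon.Quotient :=
  hφ.isNoetherianRing_of_surjective hN (RingCon.mk' _) (RingCon.mk'_surjective _)
    fun _ hr => toQuotient_eq_zero.2 hr

lemma BlockMul.isNoetherianRing_op {N : ℕ} (hφ : BlockMul N φ) (hN : 0 < N) :
    IsNoetherianRing (syntacticIdeal φ).ringCon.Quotientᵐᵒᵖ := by
  refine hφ.reverse.isNoetherianRing_of_surjective hN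
    ((RingHom.op (RingCon.mk' (syntacticIdeal φ).ringCon)).comp
      (starRingEquiv : FA K ≃+* (FA K)ᵐᵒᵖ).toRingHom) ?_ fun r hr => ?_
  · intro y
    obtain ⟨x, hx⟩ := RingCon.mk'_surjective _ y.unop
    refine ⟨star x, ?_⟩
    apply MulOpposite.unop_injective
    simpa using hx
  · apply MulOpposite.unop_injective
    exact toQuotient_eq_zero.2 (star_mem_syntacticIdeal hr)

lemma BlockMul.rank_map_le {N : ℕ} (hφ : BlockMul N φ) (hN : 0 < N) :
    ∃ c : ℕ, ∀ n : ℕ, Module.rank K ((Adeg K n).map (mkLin K (syntacticIdeal φ).ringCon)) ≤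
      (c : Cardinal) := by
  have : Fintype {l : List (Fin 2) | l.length < N} := (List.finite_length_lt (Fin 2) N).fintype
  let T := {l : List (Fin 2) | l.length < N}
  refine ⟨Fintype.card (T × T), fun n => ?_⟩
  let Ψ : FA K →ₗ[K] (T × T → K) := LinearMap.pi fun pq =>
    lcoeff K (pq.1.1.length + n + pq.2.1.length) ∘ₗ wordPoly φ ∘ₗ
      LinearMap.mulLeft K (mono K pq.1.1) ∘ₗ LinearMap.mulRight K (mono K pq.2.1)
  let f := mkLin K (syntacticIdeal φ).ringCon ∘ₗ (Adeg K n).subtype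
  have hker : LinearMap.ker (Ψ ∘ₗ (Adeg K n).subtype) ≤ LinearMap.ker f := by
    rintro ⟨r, hr⟩ h
    refine toQuotient_eq_zero.2 (hφ.mem_syntacticIdeal_of_short hN fun p q hp hq => ?_)
    have h1 : coeff (wordPoly φ (mono K p * (r * mono K q))) (p.length + n + q.length) = 0 :=
      congrFun (LinearMap.mem_ker.1 h) (⟨p, hp⟩, ⟨q, hq⟩)
    obtain ⟨c, hc⟩ := wordPoly_of_mem_Adeg φ
      (mul_mem_Adeg (mul_mem_Adeg (mono_mem_Adeg p) hr) (mono_mem_Adeg q))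
    rw [← mul_assoc, hc, coeff_monomial_same] at h1
    change wordPoly φ (mono K p * r * mono K q) = 0
    rw [hc, h1, map_zero]
  have hrange : (Adeg K n).map (mkLin K (syntacticIdeal φ).ringCon) = LinearMap.range f := by
    rw [LinearMap.range_comp, Submodule.range_subtype]
  rw [hrange, ← f.quotKerEquivRange.rank_eq]
  refine ((Submodule.factor hker).rank_le_of_surjective (Submodule.factor_surjective hker)).trans ?_
  rw [(Ψ ∘ₗ (Adeg K n).subtype).quotKerEquivRange.rank_eq]
  refine (Submodule.rank_le _).trans_eq ?_
  rw [rank_fun']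

lemma BlockMul.wordPoly_one {N : ℕ} (hφ : BlockMul N φ) {w : List (Fin 2)} (hw : φ w = 1) :
    wordPoly φ 1 = 1 := by
  have h := hφ.mul [] w (by simp)
  rw [List.nil_append, hw, mul_one] at h
  rw [← mono_nil, wordPoly_mono, ← h]
  simp

lemma BlockMul.wordPoly_pow {N : ℕ} (hφ : BlockMul N φ) {w : List (Fin 2)} (hwN : w.length = N)
    (hw : φ w = 1) (i : ℕ) : wordPoly φ (mono K w ^ i) = X ^ (N * i) := by
  induction i with
  | zero => simpa using hφ.wordPoly_one hw
  | succ i ih =>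
    rw [pow_succ, hφ.wordPoly_mul' (k := N) dvd_rfl _ (hwN ▸ mono_mem_Adeg w), ih, wordPoly_mono,
      hw, hwN, monomial_one_right_eq_X_pow, ← pow_add, Nat.mul_succ]

lemma BlockMul.not_finite {N : ℕ} (hφ : BlockMul N φ) {w : List (Fin 2)} (hwN : w.length = N)
    (hN : 0 < N) (hw : φ w = 1) : ¬ Module.Finite K (syntacticIdeal φ).ringCon.Quotient := by
  intro hfin
  have hli : LinearIndependent K fun i : ℕ => wordPoly φ (mono K w ^ i) := by
    have h := (basisMonomials K).linearIndependent.comp (fun i => N * i)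
      (mul_right_injective₀ hN.ne')
    convert! h using 2 with i
    rw [hφ.wordPoly_pow hwN hw]
    simp [monomial_one_right_eq_X_pow]
  have hli' : LinearIndependent K fun i : ℕ =>
      mkLin K (syntacticIdeal φ).ringCon (mono K w ^ i) := by
    rw [linearIndependent_iff] at hli ⊢
    intro l hl
    refine hli l ?_
    have h1 : mkLin K (syntacticIdeal φ).ringCon
        (Finsupp.linearCombination K (fun i => mono K w ^ i) l) = 0 := by
      rw [Finsupp.apply_linearCombination]; exact hl
    have h2 := wordPoly_eq_zero_of_mem (toQuotient_eq_zero.1 h1)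
    rwa [Finsupp.apply_linearCombination] at h2
  exact not_finite_iff_infinite.2 inferInstance hli'.finite

/-- The weight of a word cut into blocks of length `N`, as a product of the weights of the
blocks. -/
def blockWeight (N : ℕ) (g : List (Fin 2) → K) (l : List (Fin 2)) : K :=
  if N ∣ l.length then ∏ i ∈ Finset.range (l.length / N), g ((l.drop (N * i)).take N) else 0

lemma blockMul_blockWeight {N : ℕ} (hN : 0 < N) (g : List (Fin 2) → K) :
    BlockMul N (blockWeight N g) where
  eq_zero l hl := if_neg hl
  mul u v hu := by
    by_cases hv : N ∣ v.length
    · have huv : N ∣ (u ++ v).length := by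
        rw [List.length_append]; exact Nat.dvd_add hu hv
      rw [blockWeight, blockWeight, blockWeight, if_pos hu, if_pos hv, if_pos huv,
        List.length_append, Nat.add_div_of_dvd_right hu, Finset.prod_range_add]
      obtain ⟨M, hM⟩ := hu
      rw [hM, Nat.mul_div_cancel_left _ hN]
      congr 1
      · refine Finset.prod_congr rfl fun i hi => ?_
        have h1 : N * (i + 1) ≤ N * M := Nat.mul_le_mul_left _ (Finset.mem_range.1 hi)
        rw [Nat.mul_succ] at h1
        rw [List.drop_append_of_le_length (by omega), List.take_append_of_le_length]
        rw [List.length_drop]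
        omega
      · refine Finset.prod_congr rfl fun i _ => ?_
        rw [Nat.mul_add, ← hM, List.drop_append, List.drop_eq_nil_of_le (by omega)]
        simp
    · rw [blockWeight, blockWeight, blockWeight, if_neg hv, mul_zero, if_neg]
      rwa [List.length_append, Nat.dvd_add_right hu]

lemma blockWeight_of_length {N : ℕ} (hN : 0 < N) (g : List (Fin 2) → K) {l : List (Fin 2)}
    (hl : l.length = N) : blockWeight N g l = g l := by
  simp [blockWeight, hl, Nat.div_self hN, List.take_of_length_le]

lemma wordPoly_blockWeight_of_mem {N : ℕ} (hN : 0 < N) (f : FA K →ₗ[K] K) {x : FA K}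
    (hx : x ∈ Adeg K N) :
    wordPoly (blockWeight N fun l => f (mono K l)) x = monomial N (f x) := by
  refine Adeg_induction (p := fun x => wordPoly (blockWeight N fun l => f (mono K l)) x =
    monomial N (f x)) ?_ (by simp) ?_ ?_ hx
  · rintro l hl
    rw [wordPoly_mono, blockWeight_of_length hN _ hl, hl]
  · intro a b ha hb
    simp [ha, hb]
  · intro c a ha
    simp [ha, smul_monomial]

lemma mono_ne_zero (l : List (Fin 2)) : mono K l ≠ 0 := fun h => by
  have h1 := congrArg (wordPoly fun _ => (1 : K)) h
  simp at h1

lemma Adeg_zero : Adeg K 0 = 1 := by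
  rw [Submodule.one_eq_span, Adeg]
  congr 1
  ext x
  constructor
  · rintro ⟨l, hl, rfl⟩
    simp [List.length_eq_zero_iff.1 hl]
  · rintro rfl
    exact ⟨[], rfl, rfl⟩

/-- An interval shorter than `P` lies in a pair of consecutive blocks of length `P`. -/
lemma exists_aligned_block_pair {P Q i j k : ℕ} (hQ : 2 ≤ Q) (hk : k < P) (h : i + k + j = P * Q) :
    ∃ q s s' j₁, i = P * q + s ∧ j = s' + j₁ ∧ s + k + s' = P + P ∧
      P * q + (P + P) + j₁ = P * Q := by
  obtain ⟨Q, rfl⟩ := Nat.exists_eq_add_of_le' hQ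
  have e : P * (Q + 2) = P * Q + (P + P) := by ring
  have h1 : P * min (i / P) Q ≤ i :=
    (Nat.mul_le_mul_left _ (min_le_left _ _)).trans (Nat.mul_div_le _ _)
  have h2 : P * min (i / P) Q ≤ P * Q := Nat.mul_le_mul_left _ (min_le_right _ _)
  have h3 : i + k ≤ P * min (i / P) Q + (P + P) := by
    rcases min_choice (i / P) Q with h | h <;> rw [h]
    · have := Nat.div_add_mod i P
      have := Nat.mod_lt i (by omega : 0 < P)
      omega
    · omega
  refine ⟨min (i / P) Q, i - P * min (i / P) Q, P * min (i / P) Q + (P + P) - (i + k),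
    P * Q - P * min (i / P) Q, ?_⟩
  rw [e] at h ⊢
  omega

namespace UVCond

variable {U V : ℕ → Submodule K (FA K)} (hUV : UVCond K U V)
include hUV

lemma U_le (m : ℕ) : U m ≤ Adeg K (2 ^ m) := by
  cases m with
  | zero => simp [hUV.2.1]
  | succ m => exact (hUV.2.2 (m + 1) (by omega)).2.1

lemma Adeg_mul_U_le (m : ℕ) : Adeg K (2 ^ m) * U m ≤ U (m + 1) :=
  le_sup_left.trans (hUV.2.2 (m + 1) (by omega)).2.2.2.2.1

lemma U_mul_Adeg_le (m : ℕ) : U m * Adeg K (2 ^ m) ≤ U (m + 1) :=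
  le_sup_right.trans (hUV.2.2 (m + 1) (by omega)).2.2.2.2.1

lemma V_succ_le (m : ℕ) : V (m + 1) ≤ V m * V m :=
  (hUV.2.2 (m + 1) (by omega)).2.2.2.2.2

/-- `U` placed at an aligned dyadic position lies in every larger `U`. -/
lemma Adeg_mul_U_mul_Adeg_le (n d i j : ℕ) (hi : 2 ^ n ∣ i) (h : i + 2 ^ n + j = 2 ^ (n + d)) :
    Adeg K i * U n * Adeg K j ≤ U (n + d) := by
  induction d generalizing i j with
  | zero =>
    obtain ⟨rfl, rfl⟩ : i = 0 ∧ j = 0 := by rw [add_zero] at h; omega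
    simp [Adeg_zero]
  | succ d ih =>
    have h2 : 2 ^ (n + (d + 1)) = 2 ^ (n + d) + 2 ^ (n + d) := by ring
    have hd : 2 ^ n ∣ 2 ^ (n + d) := pow_dvd_pow _ (by omega)
    rcases le_or_gt (2 ^ (n + d)) i with hle | hlt
    · obtain ⟨i', rfl⟩ := Nat.exists_eq_add_of_le hle
      rw [← Adeg_mul, mul_assoc, mul_assoc, ← mul_assoc (Adeg K i')]
      exact (mul_le_mul_right (ih i' j ((Nat.dvd_add_right hd).1 hi) (by omega)) _).trans
        (hUV.Adeg_mul_U_le _)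
    · have h3 : i + 2 ^ n ≤ 2 ^ (n + d) := by
        obtain ⟨a, rfl⟩ := hi
        obtain ⟨b, hb⟩ := hd
        rw [hb] at hlt ⊢
        have := Nat.mul_le_mul_left (2 ^ n) (Nat.lt_of_mul_lt_mul_left hlt)
        rwa [Nat.mul_succ] at this
      obtain ⟨j', rfl⟩ : ∃ j', j = j' + 2 ^ (n + d) := ⟨j - 2 ^ (n + d), by omega⟩
      rw [← Adeg_mul, ← mul_assoc]
      exact (mul_le_mul_left (ih i j' hi (by omega)) _).trans (hUV.U_mul_Adeg_le _)

lemma Adeg_mul_span_mul_Adeg_le {k : ℕ} {r : FA K} (hr : r ∈ ESet K U k) {i j m : ℕ}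
    (hm : Nat.log 2 k + 2 ≤ m) (h : i + k + j = 2 ^ m) :
    Adeg K i * Submodule.span K {r} * Adeg K j ≤ U m := by
  obtain ⟨hrk, hrE⟩ := hr
  have hk : k < 2 ^ (Nat.log 2 k + 1) := Nat.lt_pow_succ_log_self one_lt_two k
  have e1 : Nat.log 2 k + 2 = Nat.log 2 k + 1 + 1 := rfl
  rw [e1] at hm hrE
  generalize Nat.log 2 k + 1 = n at *
  obtain ⟨d, rfl⟩ := Nat.exists_eq_add_of_le hm
  have em : 2 ^ (n + 1 + d) = 2 ^ n * 2 ^ (1 + d) := by ring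
  have en : 2 ^ (n + 1) = 2 ^ n + 2 ^ n := by ring
  obtain ⟨q, s, s', j₁, rfl, rfl, h1, h2⟩ :=
    exists_aligned_block_pair (by rw [pow_add]; have := Nat.one_le_two_pow (n := d); omega) hk
      (h.trans em)
  have hin : Adeg K s * Submodule.span K {r} * Adeg K s' ≤
      U n * Adeg K (2 ^ n) ⊔ Adeg K (2 ^ n) * U n := by
    refine le_trans (le_inf (mul_le_mul' (mul_le_mul' le_top le_rfl) le_top) ?_) hrE
    rw [en, ← h1, ← Adeg_mul, ← Adeg_mul]
    exact mul_le_mul' (mul_le_mul' le_rfl (by simpa using hrk)) le_rfl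
  rw [← Adeg_mul, ← Adeg_mul]
  calc _ = Adeg K (2 ^ n * q) * (Adeg K s * Submodule.span K {r} * Adeg K s') * Adeg K j₁ := by
        simp only [mul_assoc]
    _ ≤ Adeg K (2 ^ n * q) * (U n * Adeg K (2 ^ n) ⊔ Adeg K (2 ^ n) * U n) * Adeg K j₁ :=
        mul_le_mul' (mul_le_mul' le_rfl hin) le_rfl
    _ = Adeg K (2 ^ n * q) * U n * Adeg K (2 ^ n + j₁) ⊔
        Adeg K (2 ^ n * q + 2 ^ n) * U n * Adeg K j₁ := by
        simp only [Submodule.mul_sup, Submodule.sup_mul, ← Adeg_mul, mul_assoc]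
    _ ≤ U (n + 1 + d) := by
        rw [add_assoc n 1 d]
        rw [add_assoc n 1 d] at em
        refine sup_le (hUV.Adeg_mul_U_mul_Adeg_le n _ _ _ (Nat.dvd_mul_right _ _) (by omega))
          (hUV.Adeg_mul_U_mul_Adeg_le n _ _ _
            (Nat.dvd_add (Nat.dvd_mul_right _ _) dvd_rfl) (by omega))

lemma exists_V_eq_span_mono {α : ℕ} (hα : 1 ≤ α) (hdim : Module.finrank K (V α) = 1) :
    ∃ w : List (Fin 2), w.length = 2 ^ α ∧ V α = Submodule.span K {mono K w} := by
  obtain ⟨s, hs, hV⟩ := (hUV.2.2 α hα).1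
  have hfin : FiniteDimensional K (V α) := .of_finrank_pos (by omega)
  obtain ⟨x, hx⟩ : s.Nonempty := by
    rw [Set.nonempty_iff_ne_empty]
    rintro rfl
    rw [hV, Submodule.span_empty, finrank_bot] at hdim
    exact zero_ne_one hdim
  obtain ⟨w, hw, rfl⟩ := hs hx
  refine ⟨w, hw, (Submodule.eq_of_le_of_finrank_eq ?_ ?_).symm⟩
  · rw [hV]
    exact Submodule.span_mono (Set.singleton_subset_iff.2 hx)
  · rw [hdim, finrank_span_singleton (mono_ne_zero w)]

lemma V_succ_eq {m : ℕ} {v : FA K} (hv : V m = Submodule.span K {v})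
    (hdim : Module.finrank K (V (m + 1)) = 1) : V (m + 1) = Submodule.span K {v * v} := by
  have hle := hUV.V_succ_le m
  rw [hv, Submodule.span_mul_span, Set.singleton_mul_singleton] at hle
  refine Submodule.eq_of_le_of_finrank_le hle ?_
  rw [hdim]
  simpa using finrank_span_le_card (R := K) {v * v}

lemma exists_V_eq_span {α : ℕ} (hα : 1 ≤ α) (hdim : ∀ m, α ≤ m → Module.finrank K (V m) = 1)
    {m : ℕ} (hm : α ≤ m) : ∃ v, V m = Submodule.span K {v} := by
  induction m, hm using Nat.le_induction with
  | base =>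
    obtain ⟨w, _, hw⟩ := hUV.exists_V_eq_span_mono hα (hdim α le_rfl)
    exact ⟨_, hw⟩
  | succ m hm ih =>
    obtain ⟨v, hv⟩ := ih
    exact ⟨_, hUV.V_succ_eq hv (hdim _ (by omega))⟩

lemma U_succ_eq {α : ℕ} (hα : 1 ≤ α) (hdim : ∀ m, α ≤ m → Module.finrank K (V m) = 1)
    {m : ℕ} (hm : α ≤ m) :
    U (m + 1) = Adeg K (2 ^ m) * U m ⊔ U m * Adeg K (2 ^ m) := by
  refine le_antisymm ?_ (hUV.2.2 (m + 1) (by omega)).2.2.2.2.1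
  obtain ⟨v, hv⟩ := hUV.exists_V_eq_span hα hdim hm
  have hv' := hUV.V_succ_eq hv (hdim _ (by omega))
  have hA : Adeg K (2 ^ (m + 1)) ≤
      V (m + 1) ⊔ (Adeg K (2 ^ m) * U m ⊔ U m * Adeg K (2 ^ m)) := by
    have h1 := (hUV.2.2 m (by omega)).2.2.1
    rw [pow_succ, mul_two, ← Adeg_mul]
    conv_lhs => rw [← h1, Submodule.sup_mul, Submodule.mul_sup]
    refine sup_le (sup_le ?_ ?_) ?_
    · rw [hv', hv, Submodule.span_mul_span, Set.singleton_mul_singleton]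
      exact le_sup_left
    · exact (mul_le_mul' (le_sup_left.trans h1.le) le_rfl).trans
        (le_sup_left.trans le_sup_right)
    · rw [h1]
      exact le_sup_right.trans le_sup_right
  intro x hx
  obtain ⟨y, hy, z, hz, rfl⟩ := Submodule.mem_sup.1 (hA (hUV.U_le _ hx))
  have hy0 : y ∈ V (m + 1) ⊓ U (m + 1) := by
    refine ⟨hy, ?_⟩
    have := sub_mem hx ((hUV.2.2 (m + 1) (by omega)).2.2.2.2.1 hz)
    rwa [add_sub_cancel_right] at this
  rw [(hUV.2.2 (m + 1) (by omega)).2.2.2.1, Submodule.mem_bot] at hy0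
  rwa [hy0, zero_add]

/-- There is a block multiplicative weight of block length `2 ^ α` vanishing on every `U m` with
`α ≤ m` and equal to one on some word. -/
lemma exists_blockMul {α : ℕ} (hα : 1 ≤ α) (hdim : ∀ m, α ≤ m → Module.finrank K (V m) = 1) :
    ∃ (φ : List (Fin 2) → K) (w : List (Fin 2)), BlockMul (2 ^ α) φ ∧ w.length = 2 ^ α ∧
      φ w = 1 ∧ ∀ m, α ≤ m → ∀ u ∈ U m, wordPoly φ u = 0 := by
  have hN : 0 < 2 ^ α := by positivity
  obtain ⟨w, hw, hV⟩ := hUV.exists_V_eq_span_mono hα (hdim α le_rfl)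
  have hwU : mono K w ∉ U α := fun h => mono_ne_zero w <| by
    have h1 : mono K w ∈ V α ⊓ U α := ⟨hV ▸ Submodule.mem_span_singleton_self _, h⟩
    rwa [(hUV.2.2 α hα).2.2.2.1, Submodule.mem_bot] at h1
  obtain ⟨f, hf, hfU⟩ := Submodule.exists_le_ker_of_notMem hwU
  let f' := (f (mono K w))⁻¹ • f
  have hφ := blockMul_blockWeight hN fun l => f' (mono K l)
  refine ⟨_, w, hφ, hw, ?_, fun m hm => ?_⟩
  · rw [blockWeight_of_length hN _ hw]
    simp [f', hf]
  induction m, hm using Nat.le_induction with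
  | base =>
    intro u hu
    rw [wordPoly_blockWeight_of_mem hN f' (hUV.U_le _ hu)]
    simp [f', LinearMap.mem_ker.1 (hfU hu)]
  | succ m hm ih =>
    have hd : 2 ^ α ∣ 2 ^ m := pow_dvd_pow _ hm
    change U (m + 1) ≤ LinearMap.ker _
    rw [hUV.U_succ_eq hα hdim hm]
    refine sup_le (Submodule.mul_le.2 fun a ha u hu => ?_) (Submodule.mul_le.2 fun u hu a ha => ?_)
    · rw [LinearMap.mem_ker, hφ.wordPoly_mul hd ha, ih u hu, mul_zero]
    · rw [LinearMap.mem_ker, hφ.wordPoly_mul' hd _ ha, ih u hu, zero_mul]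

lemma Esub_le {α : ℕ} {φ : List (Fin 2) → K} {w : List (Fin 2)} (hφ : BlockMul (2 ^ α) φ)
    (hw : w.length = 2 ^ α) (hφw : φ w = 1) (hφU : ∀ m, α ≤ m → ∀ u ∈ U m, wordPoly φ u = 0) :
    (Esub K U : Set (FA K)) ⊆ syntacticIdeal φ := by
  let L : Submodule K (FA K) := (syntacticIdeal φ).asIdeal.restrictScalars K
  suffices h : Esub K U ≤ L from fun x hx => TwoSidedIdeal.mem_asIdeal.1 (h hx)
  refine Submodule.span_le.2 fun r hr => ?_
  simp only [Set.mem_iUnion] at hr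
  obtain ⟨k, -, hr⟩ := hr
  refine TwoSidedIdeal.mem_asIdeal.2 (mem_syntacticIdeal_iff_mono.2 fun p q => ?_)
  have hdeg := mul_mem_Adeg (mul_mem_Adeg (mono_mem_Adeg p) hr.1) (mono_mem_Adeg (K := K) q)
  by_cases hd : 2 ^ α ∣ p.length + k + q.length
  swap
  · exact hφ.wordPoly_eq_zero hd hdeg
  set T := p.length + k + q.length with hT
  set m := α + (Nat.log 2 k + 2) + T with hm
  have hTm : T ≤ 2 ^ m := (by omega : T ≤ m).trans Nat.lt_two_pow_self.le
  obtain ⟨j, hj⟩ : 2 ^ α ∣ 2 ^ m - T := Nat.dvd_sub (pow_dvd_pow _ (by omega)) hd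
  have hwj (j : ℕ) : mono K w ^ j ∈ Adeg K (2 ^ α * j) := by
    induction j with
    | zero => simp [Adeg_zero]
    | succ j ih => exact mul_mem_Adeg ih (hw ▸ mono_mem_Adeg w)
  have hU : mono K p * r * mono K q * mono K w ^ j ∈ U m := by
    rw [mul_assoc]
    refine hUV.Adeg_mul_span_mul_Adeg_le hr (i := p.length) (j := q.length + 2 ^ α * j)
      (by omega) (by omega) (Submodule.mul_mem_mul (Submodule.mul_mem_mul (mono_mem_Adeg p)
        (Submodule.mem_span_singleton_self r)) (mul_mem_Adeg (mono_mem_Adeg q) (hwj j)))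
  have h0 := hφU m (by omega) _ hU
  rw [hφ.wordPoly_mul hd hdeg, hφ.wordPoly_pow hw hφw] at h0
  exact (mul_eq_zero.1 h0).resolve_right (pow_ne_zero _ X_ne_zero)

end UVCond

end FreeAlgebraWords

/-- **Theorem 2.5.**  If `dim V(2^m) = 1` for all `m ≥ α`, then `A/E` maps onto a graded
(i.e. the kernel is homogeneous), prime, (left and right) Noetherian, infinite-dimensional
algebra of linear growth. -/
theorem statement10 (U V : ℕ → Submodule K (FA K)) (hUV : UVCond K U V)
    (α : ℕ) (hα : 1 ≤ α) (hdim : ∀ m, α ≤ m → Module.finrank K (V m) = 1) :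
    ∃ J : TwoSidedIdeal (FA K),
      (Esub K U : Set (FA K)) ⊆ J ∧ IsHomogTSI K J ∧
      ¬ Module.Finite K J.ringCon.Quotient ∧
      (∀ a b : J.ringCon.Quotient, (∀ x, a * x * b = 0) → a = 0 ∨ b = 0) ∧
      IsNoetherianRing J.ringCon.Quotient ∧
      IsNoetherianRing (J.ringCon.Quotient)ᵐᵒᵖ ∧
      (∃ c : ℕ, ∀ n : ℕ,
        Module.rank K ((Adeg K n).map (mkLin K J.ringCon)) ≤ (c : Cardinal)) := by
  obtain ⟨φ, w, hφ, hw, hφw, hφU⟩ := hUV.exists_blockMul hα hdim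
  have hN : 0 < 2 ^ α := by positivity
  refine ⟨syntacticIdeal φ, hUV.Esub_le hφ hw hφw hφU, isHomogTSI_syntacticIdeal,
    hφ.not_finite hw hN hφw, ?_, hφ.isNoetherianRing hN, hφ.isNoetherianRing_op hN,
    hφ.rank_map_le hN⟩
  intro a b hab
  obtain ⟨a, rfl⟩ := RingCon.mk'_surjective _ a
  obtain ⟨b, rfl⟩ := RingCon.mk'_surjective _ b
  exact (hφ.mem_or_mem fun x => toQuotient_eq_zero.1 (hab (RingCon.mk' _ x))).imp
    toQuotient_eq_zero.2 toQuotient_eq_zero.2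

end
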